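/- Let Y be an ℝ^d-valued random variable with E[Y] = 0 and E[exp(‖Y‖²/a)] ≤ 2 for some a ∈ (0,∞). Then for every λ ∈ ℝ^d one has E[exp(⟨λ, Y⟩)] ≤ (1 + 2a‖λ‖²) · exp(a‖λ‖²/2). -/

import Mathlib

open MeasureTheory Real
open scoped ENNReal RealInnerProductSpace

/-- A second-order Taylor bound for the real exponential, with remainder `x ^ 2 * exp |x|`. -/
theorem exp_le_one_add_add_sq_mul_exp_abs (x : ℝ) : exp x ≤ 1 + x + x ^ 2 * exp |x| := by
  have h := Complex.norm_exp_sub_sum_le_norm_mul_exp (x : ℂ) 2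
  have hx : Complex.exp x - ∑ m ∈ Finset.range 2, (x : ℂ) ^ m / m.factorial
      = ((exp x - (1 + x) : ℝ) : ℂ) := by
    simp [Finset.sum_range_succ]
  rw [hx, Complex.norm_real, Complex.norm_real, norm_eq_abs, norm_eq_abs, sq_abs] at h
  linarith [le_abs_self (exp x - (1 + x))]

/-- The exponential of an inner product is bounded by its first-order expansion plus a multiple
of `exp (‖y‖ ^ 2 / a)`. -/
theorem exp_inner_le {E : Type*} [NormedAddCommGroup E] [InnerProductSpace ℝ E]
    {a : ℝ} (ha : 0 < a) (l y : E) :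
    exp ⟪l, y⟫ ≤ 1 + ⟪l, y⟫ + a * ‖l‖ ^ 2 * exp (a * ‖l‖ ^ 2 / 2) * exp (‖y‖ ^ 2 / a) := by
  have hx : |⟪l, y⟫| ≤ ‖l‖ * ‖y‖ := abs_real_inner_le_norm l y
  set u : ℝ := ‖y‖ ^ 2 / (2 * a) with hu
  have hy : ‖y‖ ^ 2 = 2 * a * u := by rw [hu]; field_simp
  have hua : ‖y‖ ^ 2 / a = u + u := by rw [hu]; field_simp; ring
  have hyoung : ‖l‖ * ‖y‖ ≤ a * ‖l‖ ^ 2 / 2 + u := by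
    have h : a * ‖l‖ ^ 2 / 2 + u - ‖l‖ * ‖y‖ = (a * ‖l‖ - ‖y‖) ^ 2 / (2 * a) := by
      rw [hu]; field_simp; ring
    have : 0 ≤ (a * ‖l‖ - ‖y‖) ^ 2 / (2 * a) := by positivity
    linarith
  have hexp : 2 * u ≤ exp u := by
    have := quadratic_le_exp_of_nonneg (show 0 ≤ u by positivity)
    nlinarith [sq_nonneg (u - 1)]
  have hsq : ⟪l, y⟫ ^ 2 ≤ a * ‖l‖ ^ 2 * exp u := by
    calc ⟪l, y⟫ ^ 2 = |⟪l, y⟫| ^ 2 := (sq_abs _).symm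
      _ ≤ (‖l‖ * ‖y‖) ^ 2 := by gcongr
      _ = a * ‖l‖ ^ 2 * (2 * u) := by rw [mul_pow, hy]; ring
      _ ≤ a * ‖l‖ ^ 2 * exp u := by gcongr
  calc exp ⟪l, y⟫ ≤ 1 + ⟪l, y⟫ + ⟪l, y⟫ ^ 2 * exp |⟪l, y⟫| :=
        exp_le_one_add_add_sq_mul_exp_abs _
    _ ≤ 1 + ⟪l, y⟫ + a * ‖l‖ ^ 2 * exp u * exp (a * ‖l‖ ^ 2 / 2 + u) := by
        gcongr
        exact hx.trans hyoung
    _ = _ := by rw [hua, exp_add, exp_add]; ring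

/-- Let `Y` be an `ℝ^d`-valued random variable with `E[Y] = 0` and
`E[exp(‖Y‖²/a)] ≤ 2` for some `a ∈ (0,∞)`. Then for every `λ ∈ ℝ^d` one has
`E[exp(⟨λ, Y⟩)] ≤ (1 + 2a‖λ‖²) · exp(a‖λ‖²/2)`. -/
theorem sub_gaussian_mgf_bound_sharp
    {Ω : Type*} [MeasurableSpace Ω] (P : Measure Ω) [IsProbabilityMeasure P]
    {d : ℕ} (Y : Ω → EuclideanSpace ℝ (Fin d)) (hYmeas : Measurable Y)
    (a : ℝ) (ha : 0 < a)
    (hYint : Integrable Y P) (hYmean : ∫ ω, Y ω ∂P = 0)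
    (hYexp : ∫⁻ ω, ENNReal.ofReal (exp (‖Y ω‖ ^ 2 / a)) ∂P ≤ 2)
    (l : EuclideanSpace ℝ (Fin d)) :
    ∫⁻ ω, ENNReal.ofReal (exp (⟪l, Y ω⟫)) ∂P
      ≤ ENNReal.ofReal ((1 + 2 * a * ‖l‖ ^ 2) * exp (a * ‖l‖ ^ 2 / 2)) := by
  have hexp_meas : Measurable fun ω => exp (‖Y ω‖ ^ 2 / a) := by fun_prop
  have hexp_nonneg : 0 ≤ᵐ[P] fun ω => exp (‖Y ω‖ ^ 2 / a) := ae_of_all _ fun ω => (exp_pos _).le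
  have hexp_int : Integrable (fun ω => exp (‖Y ω‖ ^ 2 / a)) P :=
    (lintegral_ofReal_ne_top_iff_integrable hexp_meas.aestronglyMeasurable hexp_nonneg).1
      (hYexp.trans_lt ENNReal.ofNat_lt_top).ne
  have hexp_le : ∫ ω, exp (‖Y ω‖ ^ 2 / a) ∂P ≤ 2 := by
    rw [integral_eq_lintegral_of_nonneg_ae hexp_nonneg hexp_meas.aestronglyMeasurable]
    exact ENNReal.toReal_le_of_le_ofReal zero_le_two (by simpa using hYexp)
  have hinner_int : Integrable (fun ω => ⟪l, Y ω⟫) P := hYint.const_inner l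
  have hinner_mean : ∫ ω, ⟪l, Y ω⟫ ∂P = 0 := by
    rw [integral_inner hYint, hYmean, inner_zero_right]
  set c : ℝ := a * ‖l‖ ^ 2 * exp (a * ‖l‖ ^ 2 / 2) with hc
  have hc_nonneg : 0 ≤ c := by positivity
  have hlin_int : Integrable (fun ω => 1 + ⟪l, Y ω⟫) P := (integrable_const 1).add hinner_int
  have hle (ω : Ω) : exp ⟪l, Y ω⟫ ≤ 1 + ⟪l, Y ω⟫ + c * exp (‖Y ω‖ ^ 2 / a) :=
    exp_inner_le ha l (Y ω)
  calc ∫⁻ ω, ENNReal.ofReal (exp ⟪l, Y ω⟫) ∂P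
      ≤ ∫⁻ ω, ENNReal.ofReal (1 + ⟪l, Y ω⟫ + c * exp (‖Y ω‖ ^ 2 / a)) ∂P :=
        lintegral_mono fun ω => ENNReal.ofReal_le_ofReal (hle ω)
    _ = ENNReal.ofReal (∫ ω, (1 + ⟪l, Y ω⟫ + c * exp (‖Y ω‖ ^ 2 / a)) ∂P) :=
        (ofReal_integral_eq_lintegral_ofReal (hlin_int.add (hexp_int.const_mul c))
          (ae_of_all _ fun ω => (exp_pos _).le.trans (hle ω))).symm
    _ ≤ _ := by
        apply ENNReal.ofReal_le_ofReal
        rw [integral_add hlin_int (hexp_int.const_mul c),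
          integral_add (integrable_const 1) hinner_int, integral_const_mul, hinner_mean]
        have h1 : 1 ≤ exp (a * ‖l‖ ^ 2 / 2) := one_le_exp (by positivity)
        have h2 := mul_le_mul_of_nonneg_left hexp_le hc_nonneg
        simp only [integral_const, probReal_univ, smul_eq_mul, mul_one, add_zero]
        rw [add_mul, one_mul]
        linarith
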